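/- Let d ≥ 6 and m = d−3. None of the four couples (Σ_{m,2,2},(4,0,m−3)), (Σ_{m,2,2},(3,1,m−3)), (Σ_{m,2,2},(2,2,m−3)), (Σ_{m,2,2},(1,3,m−3)) is realizable; that is, no hyperbolic polynomial of degree d realizes any of these couples. -/

import Mathlib

open Polynomial Finset

/-- A real polynomial `P` of degree `d` defines the sign pattern `Σ_{m,n,q}`:
reading the coefficients from that of `x^d` down to the constant term, the first
`m` are positive, the next `n` are negative and the last `q` are positive
(in particular all `d+1` coefficients are nonzero), where `m + n + q = d + 1`. -/
def SignPatternMNQ (P : Polynomial ℝ) (d m n q : ℕ) : Prop :=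
  m + n + q = d + 1 ∧ 0 < m ∧ 0 < n ∧ 0 < q ∧
  (∀ k, k ≤ d → (d - k < m ∨ m + n ≤ d - k) → 0 < P.coeff k) ∧
  (∀ k, k ≤ d → (m ≤ d - k ∧ d - k < m + n) → P.coeff k < 0)

/-- The couple `(Σ_{m,n,q}, (u,v,w))` is realizable (in degree `d`): there is a
hyperbolic polynomial `P` of degree `d` defining the sign pattern `Σ_{m,n,q}`,
whose roots are exactly two positive numbers `β < α` together with `d - 2`
negative numbers `-γ i`, all moduli being distinct, such that exactly `u` of
the `γ i` are `< β`, exactly `v` lie in `(β, α)` and exactly `w` are `> α`. -/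
def RealizesCouple (d m n q u v w : ℕ) : Prop :=
  ∃ (P : Polynomial ℝ) (α β : ℝ) (γ : Fin (d - 2) → ℝ),
    P.natDegree = d ∧
    SignPatternMNQ P d m n q ∧
    0 < β ∧ β < α ∧
    StrictMono γ ∧ (∀ i, 0 < γ i) ∧ (∀ i, γ i ≠ β ∧ γ i ≠ α) ∧
    P.roots = (α ::ₘ β ::ₘ Multiset.map (fun i => -γ i) Finset.univ.val) ∧
    (Finset.univ.filter (fun i => γ i < β)).card = u ∧
    (Finset.univ.filter (fun i => β < γ i ∧ γ i < α)).card = v ∧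
    (Finset.univ.filter (fun i => α < γ i)).card = w

/-- Quadratic inequalities between the five lowest coefficients of a polynomial which are
preserved under multiplication by `X + C t` with `0 < t`. -/
structure LowCoeffBounds (G : Polynomial ℝ) : Prop where
  zero_pos : 0 < G.coeff 0
  one_pos : 0 < G.coeff 1
  two_pos : 0 < G.coeff 2
  three_le : G.coeff 0 * G.coeff 3 ≤ G.coeff 1 * G.coeff 2
  four_le : G.coeff 0 * G.coeff 4 ≤ G.coeff 2 ^ 2

theorem coeff_succ_X_add_C_mul (t : ℝ) (G : Polynomial ℝ) (k : ℕ) :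
    ((X + C t) * G).coeff (k + 1) = G.coeff k + t * G.coeff (k + 1) := by
  simp [add_mul, coeff_X_mul]

theorem coeff_zero_X_add_C_mul (t : ℝ) (G : Polynomial ℝ) :
    ((X + C t) * G).coeff 0 = t * G.coeff 0 := by
  simp [add_mul]

theorem LowCoeffBounds.X_add_C_mul {G : Polynomial ℝ} (h : LowCoeffBounds G) {t : ℝ}
    (ht : 0 < t) : LowCoeffBounds ((X + C t) * G) := by
  obtain ⟨h0, h1, h2, h3, h4⟩ := h
  constructor <;> simp only [coeff_succ_X_add_C_mul, coeff_zero_X_add_C_mul]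
  · positivity
  · positivity
  · positivity
  · nlinarith [mul_le_mul_of_nonneg_left h3 (sq_nonneg t), mul_pos ht (mul_pos h1 h1),
      mul_pos h0 h1]
  · nlinarith [mul_le_mul_of_nonneg_left h4 (sq_nonneg t), mul_le_mul_of_nonneg_left h3 ht.le,
      mul_pos ht (mul_pos h1 h2), mul_pos h1 h1]

theorem LowCoeffBounds.mul_prod_X_add_C {ι : Type*} {G : Polynomial ℝ} (h : LowCoeffBounds G)
    (s : Finset ι) (γ : ι → ℝ) (hγ : ∀ i, 0 < γ i) :
    LowCoeffBounds ((∏ i ∈ s, (X + C (γ i))) * G) := by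
  classical
  induction s using Finset.induction_on with
  | empty => simpa using h
  | insert i s hi ih =>
    rw [Finset.prod_insert hi, mul_assoc]
    exact ih.X_add_C_mul (hγ i)

theorem lowCoeffBounds_C_sub_X_mul {α a b c : ℝ} (ha : 0 < a) (hb : 0 < b) (hc : 0 < c)
    (haα : a < α) (hbα : b < α) (hcα : c < α) :
    LowCoeffBounds ((X + C a) * ((X + C b) * ((X + C c) * (C α - X)))) := by
  have hα : 0 < α := ha.trans haα
  have hab : a * b < α * b := mul_lt_mul_of_pos_right haα hb
  have hbc : b * c < α * c := mul_lt_mul_of_pos_right hbα hc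
  have hca : c * a < α * a := mul_lt_mul_of_pos_right hcα ha
  have h1 : 0 < α * (a * b + b * c + c * a) - a * b * c := by
    nlinarith [mul_pos hα (mul_pos hb hc), mul_pos hα (mul_pos hc ha),
      mul_lt_mul_of_pos_right hcα (mul_pos ha hb)]
  have h2 : 0 < α * (a + b + c) - (a * b + b * c + c * a) := by nlinarith
  constructor <;> simp only [coeff_succ_X_add_C_mul, coeff_zero_X_add_C_mul] <;>
    simp [coeff_X, coeff_C]
  · positivity
  · linarith
  · linarith
  · have hr : 0 < a * b * c := by positivity
    have hx : 0 < (α - a) * (b * c) := mul_pos (sub_pos.2 haα) (mul_pos hb hc)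
    have hy : 0 < (α - b) * (c * a) := mul_pos (sub_pos.2 hbα) (mul_pos hc ha)
    have hz : 0 < (α - c) * (a * b) := mul_pos (sub_pos.2 hcα) (mul_pos ha hb)
    have key : ∀ r x y z : ℝ, 0 < r → 0 < x → 0 < y → 0 < z →
        0 ≤ (2 * r + (x + y + z)) * (r * (x + y + z) + (x * y + y * z + z * x)) + 2 * r ^ 3 +
          r ^ 2 * (x + y + z) - x * y * z := by
      intro r x y z hr hx hy hz
      have : 0 ≤ (2 * r + (y + z)) * (r * (x + y + z) + (x * y + y * z + z * x)) +
          x * (r * (x + y + z) + (x * y + z * x)) + 2 * r ^ 3 + r ^ 2 * (x + y + z) := by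
        positivity
      linarith
    refine sub_nonneg.1 (nonneg_of_mul_nonneg_right (a := α * (a * b * c)) ?_ (by positivity))
    refine (key _ _ _ _ hr hx hy hz).trans_eq ?_
    ring
  · nlinarith [mul_pos (mul_pos ha hb) (mul_pos hc hα), sq_nonneg (α * (a + b + c) - (a * b + b * c + c * a))]

/-- The coefficients of `x²` and `x⁴` of `(x + δ)(β - x) G` cannot be respectively negative
and positive. -/
theorem LowCoeffBounds.coeff_four_neg {G : Polynomial ℝ} (h : LowCoeffBounds G) {β δ : ℝ}
    (hδ : 0 < δ) (hδβ : δ < β) (hneg : ((X + C δ) * ((C β - X) * G)).coeff 2 < 0) :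
    ((X + C δ) * ((C β - X) * G)).coeff 4 < 0 := by
  obtain ⟨h0, h1, h2, h3, h4⟩ := h
  simp only [coeff_succ_X_add_C_mul, sub_mul, coeff_sub, coeff_C_mul,
    coeff_X_mul] at hneg ⊢
  refine neg_of_mul_neg_right (a := G.coeff 0) ?_ h0.le
  have hβδ : 0 < β * δ := mul_pos (hδ.trans hδβ) hδ
  nlinarith [mul_le_mul_of_nonneg_left h4 hβδ.le,
    mul_le_mul_of_nonneg_left h3 (sub_pos.2 hδβ).le, mul_neg_of_pos_of_neg h2 hneg]

/-- If a negative root has modulus below the smaller positive root, then at most three moduli of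
negative roots are below the larger one. -/
theorem not_realizesCouple_of_add_eq_four {d u v w : ℕ} (hd : 6 ≤ d) (hu : 0 < u)
    (huv : u + v = 4) : ¬ RealizesCouple d (d - 3) 2 2 u v w := by
  rintro ⟨P, α, β, γ, hdeg, ⟨-, -, -, -, hpos, hneg⟩, hβ, hβα, -, hγ, hne, hroots, hcu, hcv, -⟩
  have hlead : 0 < P.leadingCoeff := by
    rw [leadingCoeff, hdeg]
    exact hpos d le_rfl (Or.inl (by omega))
  have hP2 : P.coeff 2 < 0 := hneg 2 (by omega) (by omega)
  have hP4 : 0 < P.coeff 4 := hpos 4 (by omega) (Or.inl (by omega))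
  obtain ⟨i, hi⟩ := Finset.card_pos.1 (hcu ▸ hu)
  have hiβ : γ i < β := (Finset.mem_filter.1 hi).2
  have hcard : (Finset.univ.filter (fun j => γ j < α)).card = 4 := by
    rw [← huv, ← hcu, ← hcv, ← Finset.card_union_of_disjoint]
    · congr 1
      ext j
      have := (hne j).1
      simp only [mem_filter, mem_univ, true_and, mem_union]
      grind
    · rw [Finset.disjoint_filter]
      intro j _ h
      exact fun h' => lt_asymm h h'.1
  have hcard3 : ((Finset.univ.filter (fun j => γ j < α)).erase i).card = 3 := by
    rw [Finset.card_erase_of_mem (by simpa using hiβ.trans hβα), hcard]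
  obtain ⟨a, b, c, hab, hac, hbc, habc⟩ := Finset.card_eq_three.1 hcard3
  have hmem : ∀ j ∈ ({a, b, c} : Finset (Fin (d - 2))), j ≠ i ∧ γ j < α := by
    intro j hj
    rw [← habc] at hj
    simpa using hj
  obtain ⟨hai, haα⟩ := hmem a (by simp)
  obtain ⟨hbi, hbα⟩ := hmem b (by simp)
  obtain ⟨hci, hcα⟩ := hmem c (by simp)
  set s : Finset (Fin (d - 2)) := {i, a, b, c} with hs
  have hprod : ∏ j ∈ s, (X + C (γ j)) =
      (X + C (γ i)) * ((X + C (γ a)) * ((X + C (γ b)) * (X + C (γ c)))) := by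
    rw [hs, Finset.prod_insert (by simp [hai.symm, hbi.symm, hci.symm]),
      Finset.prod_insert (by simp [hab, hac]), Finset.prod_pair hbc]
  set G := (∏ j ∈ sᶜ, (X + C (γ j))) *
    ((X + C (γ a)) * ((X + C (γ b)) * ((X + C (γ c)) * (C α - X)))) with hG
  have hGb : LowCoeffBounds G :=
    (lowCoeffBounds_C_sub_X_mul (hγ a) (hγ b) (hγ c) haα hbα hcα).mul_prod_X_add_C _ γ hγ
  have hP : P = C P.leadingCoeff * ((X + C (γ i)) * ((C β - X) * G)) := by
    have h := C_leadingCoeff_mul_prod_multiset_X_sub_C (p := P) (by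
      rw [hroots, hdeg]
      simp
      omega)
    rw [hroots] at h
    simp only [Multiset.map_cons, Multiset.prod_cons, Multiset.map_map, Function.comp_def,
      C_neg, sub_neg_eq_add] at h
    rw [← Finset.prod_eq_multiset_prod, ← Finset.prod_mul_prod_compl s, hprod] at h
    conv_lhs => rw [← h]
    rw [hG]
    ring
  rw [hP, coeff_C_mul] at hP2 hP4
  exact lt_asymm (pos_of_mul_pos_right hP4 hlead.le)
    (hGb.coeff_four_neg (hγ i) hiβ (neg_of_mul_neg_right hP2 hlead.le))

/-- Theorem 1 (3): for `d ≥ 6` and `m = d - 3`, none of the couples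
`(Σ_{m,2,2}, (4,0,m-3))`, `(Σ_{m,2,2}, (3,1,m-3))`, `(Σ_{m,2,2}, (2,2,m-3))`
and `(Σ_{m,2,2}, (1,3,m-3))` is realizable. -/
theorem stmt2 (d : ℕ) (hd : 6 ≤ d) :
    ¬ RealizesCouple d (d - 3) 2 2 4 0 (d - 3 - 3) ∧
    ¬ RealizesCouple d (d - 3) 2 2 3 1 (d - 3 - 3) ∧
    ¬ RealizesCouple d (d - 3) 2 2 2 2 (d - 3 - 3) ∧
    ¬ RealizesCouple d (d - 3) 2 2 1 3 (d - 3 - 3) :=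
  ⟨not_realizesCouple_of_add_eq_four hd (by norm_num) (by norm_num),
    not_realizesCouple_of_add_eq_four hd (by norm_num) (by norm_num),
    not_realizesCouple_of_add_eq_four hd (by norm_num) (by norm_num),
    not_realizesCouple_of_add_eq_four hd (by norm_num) (by norm_num)⟩
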